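/- arXiv:2108.02173 — 2 statements merged into one kernel-verified Lean document; each statement's English description precedes it below -/
import Mathlib

section
/- Let C be a cochain complex of vector spaces over ℚ (indexed by the natural numbers) and let φ : C → C be a morphism of cochain complexes such that for every n the component φ_n : C^n → C^n is diagonalizable. Then for every n the endomorphism induced by φ on the n-th cohomology group H^n(C) is diagonalizable. -/
/-- A linear endomorphism is diagonalizable if the supremum of its eigenspaces
is the whole space. -/
def IsDiagonalizable {k V : Type*} [Field k] [AddCommGroup V] [Module k V]
    (f : V →ₗ[k] V) : Prop :=
  (⨆ μ : k, Module.End.eigenspace f μ) = ⊤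

open Polynomial in
theorem ker_aeval_prod_X_sub_C_le_iSup_eigenspace {k V : Type*} [Field k] [AddCommGroup V]
    [Module k V] (f : Module.End k V) (s : Finset k) :
    LinearMap.ker (aeval f (∏ μ ∈ s, (X - C μ))) ≤ ⨆ μ, f.eigenspace μ := by
  classical
  induction s using Finset.induction_on with
  | empty => simp [Module.End.one_eq_id]
  | insert a s ha ih =>
    have h : IsCoprime (X - C a) (∏ μ ∈ s, (X - C μ)) :=
      IsCoprime.prod_right fun μ hμ =>
        isCoprime_X_sub_C_of_isUnit_sub (sub_ne_zero.2 (ne_of_mem_of_not_mem hμ ha).symm).isUnit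
    rw [Finset.prod_insert ha, ← sup_ker_aeval_eq_ker_aeval_mul_of_coprime f h]
    refine sup_le ((le_of_eq ?_).trans (le_iSup _ a)) ih
    rw [Module.End.eigenspace_def, map_sub, aeval_X, aeval_C, Algebra.algebraMap_eq_smul_one]

open Polynomial in
/-- A linear endomorphism is diagonalizable iff each vector is annihilated by a product of
distinct linear factors evaluated at the endomorphism. -/
theorem isDiagonalizable_iff_exists_aeval_prod_eq_zero {k V : Type*} [Field k] [AddCommGroup V]
    [Module k V] {f : Module.End k V} :
    IsDiagonalizable f ↔ ∀ v, ∃ s : Finset k, aeval f (∏ μ ∈ s, (X - C μ)) v = 0 := by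
  classical
  refine ⟨fun h v => ?_, fun h => eq_top_iff.2 fun v _ => ?_⟩
  · have mono {s t : Finset k} (hst : s ⊆ t) {v : V}
        (hv : aeval f (∏ μ ∈ s, (X - C μ)) v = 0) : aeval f (∏ μ ∈ t, (X - C μ)) v = 0 := by
      rw [← Finset.prod_sdiff hst, map_mul, Module.End.mul_apply, hv, map_zero]
    have hv : v ∈ ⨆ μ, f.eigenspace μ := by
      rw [show (⨆ μ, f.eigenspace μ) = ⊤ from h]
      trivial
    induction hv using Submodule.iSup_induction' with
    | mem μ x hx =>
      refine ⟨{μ}, ?_⟩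
      simp [Module.End.mem_eigenspace_iff.1 hx]
    | zero => exact ⟨∅, map_zero _⟩
    | add x y _ _ hx hy =>
      obtain ⟨s, hs⟩ := hx
      obtain ⟨t, ht⟩ := hy
      refine ⟨s ∪ t, ?_⟩
      rw [map_add, mono Finset.subset_union_left hs, mono Finset.subset_union_right ht, add_zero]
  · obtain ⟨s, hs⟩ := h v
    exact ker_aeval_prod_X_sub_C_le_iSup_eigenspace f s hs

theorem aeval_apply_of_intertwining {k V W : Type*} [Field k] [AddCommGroup V] [Module k V]
    [AddCommGroup W] [Module k W] {f : Module.End k V} {g : Module.End k W} {i : V →ₗ[k] W}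
    (h : ∀ v, i (f v) = g (i v)) (p : Polynomial k) (v : V) :
    i (Polynomial.aeval f p v) = Polynomial.aeval g p (i v) := by
  induction p using Polynomial.induction_on generalizing v with
  | C a => simp
  | add p q hp hq => simp [hp, hq]
  | monomial n a ih =>
    rw [pow_succ, ← mul_assoc, map_mul _ (_ * _) _,
      map_mul _ (_ * _) _, Module.End.mul_apply, Module.End.mul_apply, ih,
      Polynomial.aeval_X, Polynomial.aeval_X, h]

theorem IsDiagonalizable.of_injective {k V W : Type*} [Field k] [AddCommGroup V] [Module k V]
    [AddCommGroup W] [Module k W] {f : Module.End k V} {g : Module.End k W} {i : V →ₗ[k] W}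
    (hg : IsDiagonalizable g) (hi : Function.Injective i) (h : ∀ v, i (f v) = g (i v)) :
    IsDiagonalizable f := by
  rw [isDiagonalizable_iff_exists_aeval_prod_eq_zero] at hg ⊢
  intro v
  obtain ⟨s, hs⟩ := hg (i v)
  exact ⟨s, hi (by rw [aeval_apply_of_intertwining h, hs, map_zero])⟩

theorem IsDiagonalizable.of_surjective {k V W : Type*} [Field k] [AddCommGroup V] [Module k V]
    [AddCommGroup W] [Module k W] {f : Module.End k V} {g : Module.End k W} {i : V →ₗ[k] W}
    (hf : IsDiagonalizable f) (hi : Function.Surjective i) (h : ∀ v, i (f v) = g (i v)) :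
    IsDiagonalizable g := by
  rw [isDiagonalizable_iff_exists_aeval_prod_eq_zero] at hf ⊢
  intro w
  obtain ⟨v, rfl⟩ := hi w
  obtain ⟨s, hs⟩ := hf v
  exact ⟨s, by rw [← aeval_apply_of_intertwining h, hs, map_zero]⟩

/-- If a morphism of cochain complexes of `ℚ`-vector spaces is diagonalizable in each
degree, then the induced endomorphism on each cohomology group is diagonalizable. -/
theorem cohomology_map_diagonalizable
    (C : CochainComplex (ModuleCat ℚ) ℕ) (φ : C ⟶ C)
    (hφ : ∀ n, IsDiagonalizable ((φ.f n).hom : C.X n →ₗ[ℚ] C.X n)) (n : ℕ) :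
    IsDiagonalizable
      ((HomologicalComplex.homologyMap φ n).hom : C.homology n →ₗ[ℚ] C.homology n) := by
  have hcycles : IsDiagonalizable (HomologicalComplex.cyclesMap φ n).hom :=
    (hφ n).of_injective (i := (C.iCycles n).hom)
      ((ModuleCat.mono_iff_injective _).1 inferInstance) fun v =>
        CategoryTheory.ConcreteCategory.congr_hom (HomologicalComplex.cyclesMap_i φ n) v
  exact hcycles.of_surjective (i := (C.homologyπ n).hom)
    ((ModuleCat.epi_iff_surjective _).1 inferInstance) fun v =>
      (CategoryTheory.ConcreteCategory.congr_hom
        (HomologicalComplex.homologyπ_naturality φ n) v).symm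
end

section
/- Let C be a cochain complex of vector spaces over ℚ and let φ : C → C be a morphism of cochain complexes such that for every n the component φ_n : C^n → C^n is diagonalizable. Then for every n, every eigenvalue of the endomorphism induced by φ on the cohomology H^n(C) is an eigenvalue of φ_n. -/
namespace Module.End

variable {k V W : Type*} [Field k] [AddCommGroup V] [Module k V] [AddCommGroup W] [Module k W]

/-- An eigenvalue of an endomorphism is an eigenvalue of any endomorphism extending it along an
injective linear map. -/
theorem HasEigenvalue.of_injective {f : End k V} {g : End k W} {i : V →ₗ[k] W}
    (hi : Function.Injective i) (h : ∀ v, g (i v) = i (f v)) {μ : k} (hμ : f.HasEigenvalue μ) :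
    g.HasEigenvalue μ := by
  obtain ⟨v, hv⟩ := hμ.exists_hasEigenvector
  refine hasEigenvalue_of_hasEigenvector (x := i v)
    (hasEigenvector_iff.2 ⟨mem_eigenspace_iff.2 ?_, ?_⟩)
  · rw [h, hv.apply_eq_smul, map_smul]
  · exact (map_ne_zero_iff i hi).2 hv.2

/-- An eigenvalue of a quotient of a diagonalizable endomorphism is an eigenvalue of the
endomorphism. -/
theorem HasEigenvalue.of_surjective {f : End k V} {g : End k W} {p : V →ₗ[k] W}
    (hf : IsDiagonalizable f) (hp : Function.Surjective p) (h : ∀ v, g (p v) = p (f v)) {μ : k}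
    (hμ : g.HasEigenvalue μ) : f.HasEigenvalue μ := by
  intro hbot
  refine hμ ?_
  have htop : (⨆ (ν : k) (_ : ν ≠ μ), g.eigenspace ν) = ⊤ := by
    rw [eq_top_iff, ← LinearMap.range_eq_top.2 hp, LinearMap.range_eq_map, ← hf,
      Submodule.map_iSup]
    refine iSup_le fun ν => ?_
    by_cases hν : ν = μ
    · subst hν
      have hbot' : f.eigenspace ν = ⊥ := hbot
      simp [hbot']
    · refine le_trans ?_ (le_iSup₂_of_le ν hν le_rfl)
      rintro _ ⟨v, hv, rfl⟩
      rw [mem_eigenspace_iff, h, mem_eigenspace_iff.1 hv, map_smul]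
  have hdisj := g.eigenspaces_iSupIndep μ
  rw [htop, disjoint_top] at hdisj
  exact hdisj

end Module.End

/-- If a morphism of cochain complexes of `ℚ`-vector spaces is diagonalizable in each
degree, then every eigenvalue of the induced endomorphism on the `n`-th cohomology
is an eigenvalue of the `n`-th component. -/
theorem cohomology_map_eigenvalues
    (C : CochainComplex (ModuleCat ℚ) ℕ) (φ : C ⟶ C)
    (hφ : ∀ n, IsDiagonalizable ((φ.f n).hom : C.X n →ₗ[ℚ] C.X n)) (n : ℕ) :
    ∀ μ : ℚ, Module.End.HasEigenvalue
        ((HomologicalComplex.homologyMap φ n).hom : C.homology n →ₗ[ℚ] C.homology n) μ →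
      Module.End.HasEigenvalue ((φ.f n).hom : C.X n →ₗ[ℚ] C.X n) μ := by
  intro μ hμ
  have hopcycles : Module.End.HasEigenvalue (HomologicalComplex.opcyclesMap φ n).hom μ :=
    hμ.of_injective (i := (C.homologyι n).hom)
      ((ModuleCat.mono_iff_injective _).1 inferInstance)
      fun v => (CategoryTheory.ConcreteCategory.congr_hom (HomologicalComplex.homologyι_naturality φ n) v).symm
  exact hopcycles.of_surjective (p := (C.pOpcycles n).hom) (hφ n)
    ((ModuleCat.epi_iff_surjective _).1 inferInstance)
    fun v => CategoryTheory.ConcreteCategory.congr_hom (HomologicalComplex.p_opcyclesMap φ n) v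
end
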